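/- Let m ≥ 3 and let R_m be the hypergraph whose vertex set is {1, 2, ..., m(m-2)} and whose edges are all subsets of cardinality m-2 of the vertex set. Then n_m equals the minimum, taken over all sub-hypergraphs R' of R_m having exactly m edges, of cov_{R_m}(T(R')). -/

import Mathlib

/-- A graph `G` is `k`-choosable if for every assignment of lists of `k` colors
to the vertices there is a proper coloring choosing each vertex's color from its list. -/
def Choosable {V : Type*} (G : SimpleGraph V) (k : ℕ) : Prop :=
  ∀ L : V → Finset ℕ, (∀ v, (L v).card = k) →
    ∃ c : V → ℕ, (∀ v, c v ∈ L v) ∧ ∀ u w, G.Adj u w → c u ≠ c w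

/-- The choice number of `G` is the least `k` such that `G` is `k`-choosable. -/
noncomputable def choiceNumber {V : Type*} (G : SimpleGraph V) : ℕ :=
  sInf {k | Choosable G k}

/-- `nm m` is the smallest integer `n` such that `ch (K_{m,n}) = m - 1`. -/
noncomputable def nm (m : ℕ) : ℕ :=
  sInf {n | choiceNumber (completeBipartiteGraph (Fin m) (Fin n)) = m - 1}


/-- `C` is an `R`-cover of the hypergraph with edge set `E`: `C` is a set of edges of
`R` such that every edge of `E` contains some edge of `C`. -/
def IsCover (R : Finset (Finset ℕ)) (E : Set (Finset ℕ)) (C : Finset (Finset ℕ)) : Prop :=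
  C ⊆ R ∧ ∀ e ∈ E, ∃ c ∈ C, c ⊆ e

/-- The minimum cardinality of an `R`-cover of the hypergraph with edge set `E`
(`⊤` if there is no cover). -/
noncomputable def covNum (R : Finset (Finset ℕ)) (E : Set (Finset ℕ)) : ℕ∞ :=
  sInf {n : ℕ∞ | ∃ C : Finset (Finset ℕ), IsCover R E C ∧ n = C.card}

/-- The edge set of the transversal hypergraph of a family of sets `S`: all
transversals of `S` (within the union of `S`) of cardinality at most `|S|`. -/
def transversalEdges (S : Finset (Finset ℕ)) : Set (Finset ℕ) :=
  {t | t ⊆ S.sup id ∧ t.card ≤ S.card ∧ ∀ s ∈ S, (s ∩ t).Nonempty}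

/-- The edge set of the hypergraph `R_m`: all subsets of cardinality `m - 2` of
`{1, 2, ..., m (m-2)}`. -/
def RmEdges (m : ℕ) : Finset (Finset ℕ) :=
  (Finset.Icc 1 (m * (m - 2))).powersetCard (m - 2)

/-- Choosability is monotone in the size of the lists. -/
theorem Choosable.mono {V : Type*} {G : SimpleGraph V} {k l : ℕ} (h : Choosable G k)
    (hkl : k ≤ l) : Choosable G l := by
  intro L hL
  have hsub : ∀ v, ∃ t ⊆ L v, t.card = k := fun v =>
    Finset.exists_subset_card_eq (by rw [hL v]; exact hkl)
  choose L' hL'L hL' using hsub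
  obtain ⟨c, hc, hadj⟩ := h L' hL'
  exact ⟨c, fun v => hL'L v (hc v), hadj⟩

theorem choiceNumber_eq_succ {V : Type*} {G : SimpleGraph V} {k : ℕ}
    (h : Choosable G (k + 1)) (h' : ¬ Choosable G k) : choiceNumber G = k + 1 := by
  refine le_antisymm (Nat.sInf_le h) (le_csInf ⟨_, h⟩ fun l hl => ?_)
  by_contra! hlt
  exact h' (Choosable.mono hl (by omega))

/-- A complete bipartite graph is not `k`-choosable iff there are lists of size `k` such that
the colors used on the left side always exhaust some list on the right side. -/
theorem not_choosable_completeBipartiteGraph_iff {α β : Type*} [Fintype α] {k : ℕ} :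
    ¬ Choosable (completeBipartiteGraph α β) k ↔
      ∃ (A : α → Finset ℕ) (B : β → Finset ℕ), (∀ i, (A i).card = k) ∧ (∀ j, (B j).card = k) ∧
        ∀ a : α → ℕ, (∀ i, a i ∈ A i) → ∃ j, B j ⊆ Finset.univ.image a := by
  constructor
  · intro h
    unfold Choosable at h
    push Not at h
    obtain ⟨L, hL, h⟩ := h
    refine ⟨fun i => L (.inl i), fun j => L (.inr j), fun i => hL _, fun j => hL _, ?_⟩
    intro a ha
    by_contra! hB
    have hfree : ∀ j, ∃ x ∈ L (.inr j), x ∉ Finset.univ.image a := fun j =>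
      Finset.not_subset.mp (hB j)
    choose b hb hba using hfree
    obtain ⟨u, w, huw, hc⟩ := h (Sum.elim a b) (by rintro (i | j) <;> simp [ha, hb])
    rcases u with i | j <;> rcases w with i' | j'
    · simp at huw
    · exact hba j' (Finset.mem_image.mpr ⟨i, Finset.mem_univ i, hc⟩)
    · exact hba j (Finset.mem_image.mpr ⟨i', Finset.mem_univ i', hc.symm⟩)
    · simp at huw
  · rintro ⟨A, B, hA, hB, h⟩ hch
    obtain ⟨c, hc, hadj⟩ := hch (Sum.elim A B) (by rintro (i | j) <;> simp [hA, hB])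
    obtain ⟨j, hj⟩ := h (fun i => c (.inl i)) fun i => hc (.inl i)
    obtain ⟨i, -, hi⟩ := Finset.mem_image.mp (hj (hc (.inr j)))
    exact hadj (.inl i) (.inr j) (by simp) hi

theorem choosable_completeBipartiteGraph_zero (m : ℕ) {k : ℕ} (hk : 1 ≤ k) :
    Choosable (completeBipartiteGraph (Fin m) (Fin 0)) k := by
  by_contra h
  obtain ⟨A, B, hA, -, h⟩ := not_choosable_completeBipartiteGraph_iff.mp h
  have hne : ∀ i, (A i).Nonempty := fun i => Finset.card_pos.mp (by rw [hA i]; exact hk)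
  choose a ha using hne
  obtain ⟨j, -⟩ := h a ha
  exact j.elim0

/-- Adding one vertex on the right side increases the choice number by at most one. -/
theorem Choosable.completeBipartiteGraph_succ {m n k : ℕ}
    (h : Choosable (completeBipartiteGraph (Fin m) (Fin n)) k) :
    Choosable (completeBipartiteGraph (Fin m) (Fin (n + 1))) (k + 1) := by
  by_contra hn
  obtain ⟨A, B, hA, hB, hAB⟩ := not_choosable_completeBipartiteGraph_iff.mp hn
  obtain ⟨x, hx⟩ : (B (Fin.last n)).Nonempty := Finset.card_pos.mp (by rw [hB]; omega)
  have hsubA : ∀ i, ∃ t ⊆ (A i).erase x, t.card = k := fun i =>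
    Finset.exists_subset_card_eq (by have := Finset.pred_card_le_card_erase (s := A i) (a := x)
                                     rw [hA] at this; omega)
  have hsubB : ∀ j, ∃ t ⊆ B j, t.card = k := fun j =>
    Finset.exists_subset_card_eq (by rw [hB]; omega)
  choose A' hA'A hA' using hsubA
  choose B' hB'B hB' using hsubB
  refine not_choosable_completeBipartiteGraph_iff.mpr
    ⟨A', fun j => B' j.castSucc, hA', fun j => hB' _, fun a ha => ?_⟩ h
  obtain ⟨j, hj⟩ := hAB a fun i => Finset.mem_of_mem_erase (hA'A i (ha i))
  induction j using Fin.lastCases with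
  | last =>
    obtain ⟨i, -, hi⟩ := Finset.mem_image.mp (hj hx)
    exact absurd hi (Finset.ne_of_mem_erase (hA'A i (ha i)))
  | cast j => exact ⟨j, (hB'B _).trans hj⟩

theorem exists_not_choosable_completeBipartiteGraph {m k : ℕ} (hkm : k ≤ m) :
    ∃ n, ¬ Choosable (completeBipartiteGraph (Fin m) (Fin n)) k := by
  let S := (Finset.range (m * k)).powersetCard k
  refine ⟨S.card, not_choosable_completeBipartiteGraph_iff.mpr
    ⟨fun i => Finset.Ico (i * k) ((i + 1) * k), fun j => (S.equivFin.symm j : Finset ℕ),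
      fun i => by simp [Nat.add_mul], fun j => ?_, fun a ha => ?_⟩⟩
  · exact (Finset.mem_powersetCard.mp (S.equivFin.symm j).2).2
  · simp only [Finset.mem_Ico] at ha
    have hdiv : ∀ i, a i / k = i := fun i => Nat.div_eq_of_lt_le (ha i).1 (ha i).2
    have hinj : Function.Injective a := fun i i' h => Fin.ext (by rw [← hdiv i, ← hdiv i', h])
    obtain ⟨t, hta, htk⟩ := Finset.exists_subset_card_eq (s := Finset.univ.image a) (n := k)
      (by rw [Finset.card_image_of_injective _ hinj]; simpa using hkm)
    have htS : t ∈ S := by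
      refine Finset.mem_powersetCard.mpr ⟨fun x hx => ?_, htk⟩
      obtain ⟨i, -, rfl⟩ := Finset.mem_image.mp (hta hx)
      exact Finset.mem_range.mpr ((ha i).2.trans_le (Nat.mul_le_mul_right k i.2))
    exact ⟨S.equivFin ⟨t, htS⟩, by simpa using hta⟩

/-- `nm m` is the least `n` for which `K_{m,n}` is not `(m - 2)`-choosable. -/
theorem isLeast_nm {m : ℕ} (hm : 3 ≤ m) :
    IsLeast {n | ¬ Choosable (completeBipartiteGraph (Fin m) (Fin n)) (m - 2)} (nm m) := by
  classical
  obtain ⟨k, rfl⟩ : ∃ k, m = k + 2 := ⟨m - 2, by omega⟩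
  have hex := exists_not_choosable_completeBipartiteGraph (m := k + 2) (k := k) (by omega)
  have hspec := Nat.find_spec hex
  have heq : choiceNumber (completeBipartiteGraph (Fin (k + 2)) (Fin (Nat.find hex))) = k + 1 := by
    refine choiceNumber_eq_succ ?_ hspec
    rcases Nat.eq_zero_or_pos (Nat.find hex) with hz | hpos
    · rw [hz] at hspec
      exact absurd (choosable_completeBipartiteGraph_zero _ (by omega)) hspec
    · obtain ⟨n, hn⟩ := Nat.exists_eq_succ_of_ne_zero hpos.ne'
      rw [hn]
      exact Choosable.completeBipartiteGraph_succ (not_not.mp (Nat.find_min hex (by omega)))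
  have hmem : nm (k + 2) ∈ {n | ¬ Choosable (completeBipartiteGraph (Fin (k + 2)) (Fin n)) k} := by
    have h : choiceNumber (completeBipartiteGraph (Fin (k + 2)) (Fin (nm (k + 2)))) = k + 1 :=
      Nat.sInf_mem (s := {n | choiceNumber (completeBipartiteGraph (Fin (k + 2)) (Fin n)) =
        k + 2 - 1}) ⟨_, heq⟩
    intro hch
    have := Nat.sInf_le (s := {l | Choosable _ l}) hch
    unfold choiceNumber at h
    omega
  have hle : nm (k + 2) ≤ Nat.find hex := Nat.sInf_le heq
  exact ⟨hmem, fun n hn => hle.trans (Nat.find_min' hex hn)⟩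

theorem not_choosable_of_isCover {m : ℕ} {R' C : Finset (Finset ℕ)} (hR' : R' ⊆ RmEdges m)
    (hcard : R'.card = m) (hC : IsCover (RmEdges m) (transversalEdges R') C) :
    ¬ Choosable (completeBipartiteGraph (Fin m) (Fin C.card)) (m - 2) := by
  have hsize : ∀ e ∈ RmEdges m, e.card = m - 2 := fun e he => (Finset.mem_powersetCard.mp he).2
  let φ := R'.equivFinOfCardEq hcard
  refine not_choosable_completeBipartiteGraph_iff.mpr
    ⟨fun i => (φ.symm i : Finset ℕ), fun j => (C.equivFin.symm j : Finset ℕ),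
      fun i => hsize _ (hR' (φ.symm i).2), fun j => hsize _ (hC.1 (C.equivFin.symm j).2),
      fun a ha => ?_⟩
  have htrans : Finset.univ.image a ∈ transversalEdges R' := by
    refine ⟨fun x hx => ?_, Finset.card_image_le.trans (by simp [hcard]), fun s hs => ?_⟩
    · obtain ⟨i, -, rfl⟩ := Finset.mem_image.mp hx
      exact Finset.mem_sup.mpr ⟨_, (φ.symm i).2, ha i⟩
    · exact ⟨a (φ ⟨s, hs⟩), Finset.mem_inter.mpr ⟨by simpa using ha (φ ⟨s, hs⟩),
        Finset.mem_image_of_mem a (Finset.mem_univ _)⟩⟩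
  obtain ⟨c, hc, hca⟩ := hC.2 _ htrans
  exact ⟨C.equivFin ⟨c, hc⟩, by simpa using hca⟩

theorem le_card_RmEdges {m : ℕ} (hm : 3 ≤ m) : m ≤ (RmEdges m).card := by
  obtain ⟨k, rfl⟩ : ∃ k, m = k + 3 := ⟨m - 3, by omega⟩
  rw [RmEdges, Finset.card_powersetCard, Nat.card_Icc]
  calc k + 3 ≤ (k + 2).choose k + (k + 2).choose (k + 1) := by
        rw [Nat.choose_succ_self_right]
        have := Nat.choose_pos (n := k + 2) (k := k) (by omega)
        omega
    _ = (k + 3).choose (k + 1) := (Nat.choose_succ_succ _ _).symm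
    _ ≤ _ := Nat.choose_le_choose _ (by rw [Nat.add_sub_cancel]; exact Nat.le_mul_of_pos_right _ (by omega))

/-- Lists witnessing that `K_{m,n}` is not `(m - 2)`-choosable yield, after an injective
relabelling of the colors, `m` edges of `R_m` whose transversals are covered by `n` edges. -/
theorem exists_isCover_of_not_choosable {m n : ℕ} (hm : 3 ≤ m)
    (h : ¬ Choosable (completeBipartiteGraph (Fin m) (Fin n)) (m - 2)) :
    ∃ R' ⊆ RmEdges m, R'.card = m ∧
      ∃ C, IsCover (RmEdges m) (transversalEdges R') C ∧ C.card ≤ n := by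
  obtain ⟨A, B, hA, hB, hAB⟩ := not_choosable_completeBipartiteGraph_iff.mp h
  let U := Finset.univ.biUnion A
  have hAU : ∀ i, A i ⊆ U := fun i => Finset.subset_biUnion_of_mem A (Finset.mem_univ i)
  have hU : U.card ≤ (Finset.Icc 1 (m * (m - 2))).card := by
    refine (Finset.card_biUnion_le_card_mul _ _ (m - 2) fun i _ => (hA i).le).trans ?_
    simp
  obtain ⟨f, hfU, hf⟩ := U.finite_toSet.exists_injOn_of_encard_le
    (t := (Finset.Icc 1 (m * (m - 2)) : Set ℕ))
    (by simpa only [Set.encard_coe_eq_coe_finsetCard, Nat.cast_le] using hU)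
  have hmem : ∀ s ⊆ U, s.card = m - 2 → s.image f ∈ RmEdges m := fun s hs hcard =>
    Finset.mem_powersetCard.mpr
      ⟨Finset.image_subset_iff.mpr fun x hx => hfU (hs hx),
        by rw [Finset.card_image_of_injOn (hf.mono hs), hcard]⟩
  obtain ⟨R', hAR', hR', hcard⟩ := Finset.exists_subsuperset_card_eq
    (s := Finset.univ.image fun i => (A i).image f) (t := RmEdges m) (n := m)
    (Finset.image_subset_iff.mpr fun i _ => hmem _ (hAU i) (hA i))
    (Finset.card_image_le.trans (by simp)) (le_card_RmEdges hm)
  refine ⟨R', hR', hcard, (Finset.univ.filter fun j => B j ⊆ U).image fun j => (B j).image f,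
    ⟨Finset.image_subset_iff.mpr fun j hj => hmem _ (Finset.mem_filter.mp hj).2 (hB j), ?_⟩, ?_⟩
  · rintro t ⟨-, -, ht⟩
    have hpick : ∀ i, ∃ x ∈ A i, f x ∈ t := fun i => by
      obtain ⟨y, hy⟩ := ht _ (hAR' (Finset.mem_image_of_mem _ (Finset.mem_univ i)))
      obtain ⟨hyA, hyt⟩ := Finset.mem_inter.mp hy
      obtain ⟨x, hx, rfl⟩ := Finset.mem_image.mp hyA
      exact ⟨x, hx, hyt⟩
    choose a ha hat using hpick
    obtain ⟨j, hj⟩ := hAB a ha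
    have hjU : B j ⊆ U := hj.trans (Finset.image_subset_iff.mpr fun i _ => hAU i (ha i))
    refine ⟨_, Finset.mem_image_of_mem _ (Finset.mem_filter.mpr ⟨Finset.mem_univ j, hjU⟩), ?_⟩
    refine Finset.image_subset_iff.mpr fun x hx => ?_
    obtain ⟨i, -, rfl⟩ := Finset.mem_image.mp (hj hx)
    exact hat i
  · exact Finset.card_image_le.trans ((Finset.card_filter_le _ _).trans (by simp))

/-- `n_m` equals the minimum over all sub-hypergraphs `R'` of `R_m` with exactly `m`
edges of `cov_{R_m}(T(R'))`. -/
theorem nm_eq_min_cover (m : ℕ) (hm : 3 ≤ m) :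
    (nm m : ℕ∞) = sInf {c : ℕ∞ | ∃ R' ⊆ RmEdges m, R'.card = m ∧
      c = covNum (RmEdges m) (transversalEdges R')} := by
  apply le_antisymm
  · refine le_sInf ?_
    rintro _ ⟨R', hR', hcard, rfl⟩
    refine le_sInf ?_
    rintro _ ⟨C, hC, rfl⟩
    exact_mod_cast (isLeast_nm hm).2 (not_choosable_of_isCover hR' hcard hC)
  · obtain ⟨R', hR', hcard, C, hC, hCn⟩ := exists_isCover_of_not_choosable hm (isLeast_nm hm).1
    have hle : covNum (RmEdges m) (transversalEdges R') ≤ C.card := sInf_le ⟨C, hC, rfl⟩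
    refine le_trans ?_ (hle.trans (by exact_mod_cast hCn))
    exact sInf_le ⟨R', hR', hcard, rfl⟩
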